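/- arXiv:2211.00444 — 5 statements merged into one kernel-verified Lean document; each statement's English description precedes it below -/
import Mathlib

section
/- With the above data, the R-linear map f : 𝔹₁ → 𝔹₂ induced by (b₁, b₂) ↦ (f₁(b₁), f₂(b₂)) is well defined and injective; consequently 0 → 𝔹₁ →^{f} 𝔹₂ →^{η} 𝔽 → 0 is a short exact sequence of R-modules, where η is the quotient map. (This is the horizontal exact sequence in Rabi's lemma, Lemma 3.4 of the paper.) -/
variable {R : Type*} [Ring R]
variable {A1 B11 B12 B21 B22 B3 C1 : Type*}
variable [AddCommGroup A1] [Module R A1]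
variable [AddCommGroup B11] [Module R B11] [AddCommGroup B12] [Module R B12]
variable [AddCommGroup B21] [Module R B21] [AddCommGroup B22] [Module R B22]
variable [AddCommGroup B3] [Module R B3] [AddCommGroup C1] [Module R C1]

/-- The kernel of the difference map `(b₁,b₂) ↦ p(b₁) − q(b₂)` on a product. -/
def rabiKer {M N P : Type*} [AddCommGroup M] [Module R M] [AddCommGroup N] [Module R N]
    [AddCommGroup P] [Module R P] (p : M →ₗ[R] P) (q : N →ₗ[R] P) :
    Submodule R (M × N) :=
  LinearMap.ker (p.comp (LinearMap.fst R M N) - q.comp (LinearMap.snd R M N))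

lemma mem_rabiKer {M N P : Type*} [AddCommGroup M] [Module R M] [AddCommGroup N] [Module R N]
    [AddCommGroup P] [Module R P] {p : M →ₗ[R] P} {q : N →ₗ[R] P} {x : M × N} :
    x ∈ rabiKer p q ↔ p x.1 = q x.2 := by
  simp [rabiKer, LinearMap.mem_ker, sub_eq_zero]

lemma apply_eq_zero_of_exact {M N : Type*} [AddCommGroup M] [Module R M]
    [AddCommGroup N] [Module R N] {f : M →ₗ[R] N} {P : Type*} [AddCommGroup P] [Module R P]
    {p : N →ₗ[R] P} (he : LinearMap.range f = LinearMap.ker p) (x : M) : p (f x) = 0 :=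
  LinearMap.mem_ker.mp (he ▸ LinearMap.mem_range_self f x)

/-- `H₁ = ker((b₁,b₂) ↦ π₁(b₁) − π₂(b₂)) ⊆ B₁¹ × B₁²`. -/
def rabiH1 (pi1 : B11 →ₗ[R] C1) (pi2 : B12 →ₗ[R] C1) : Submodule R (B11 × B12) :=
  rabiKer pi1 pi2

/-- `H₂ = ker((b₁,b₂) ↦ p₁(b₁) − p₂(b₂)) ⊆ B₂¹ × B₂²`. -/
def rabiH2 (p1 : B21 →ₗ[R] B3) (p2 : B22 →ₗ[R] B3) : Submodule R (B21 × B22) :=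
  rabiKer p1 p2

/-- `D₁ ⊆ H₁` is the image of `a ↦ (i₁(a), i₂(a))`. -/
def rabiD1 (i1 : A1 →ₗ[R] B11) (i2 : A1 →ₗ[R] B12)
    (pi1 : B11 →ₗ[R] C1) (pi2 : B12 →ₗ[R] C1)
    (hv1 : LinearMap.range i1 = LinearMap.ker pi1)
    (hv2 : LinearMap.range i2 = LinearMap.ker pi2) :
    Submodule R (rabiH1 pi1 pi2) :=
  LinearMap.range (LinearMap.codRestrict (rabiH1 pi1 pi2) (i1.prod i2) (fun a => by
    rw [rabiH1, mem_rabiKer]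
    simp [apply_eq_zero_of_exact hv1, apply_eq_zero_of_exact hv2]))

/-- `𝔹₁ = H₁/D₁`. -/
abbrev rabiB1 (i1 : A1 →ₗ[R] B11) (i2 : A1 →ₗ[R] B12)
    (pi1 : B11 →ₗ[R] C1) (pi2 : B12 →ₗ[R] C1)
    (hv1 : LinearMap.range i1 = LinearMap.ker pi1)
    (hv2 : LinearMap.range i2 = LinearMap.ker pi2) :=
  rabiH1 pi1 pi2 ⧸ rabiD1 i1 i2 pi1 pi2 hv1 hv2

/-- `D₂ ⊆ H₂` is the image of `a ↦ (f₁(i₁(a)), f₂(i₂(a)))`. -/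
def rabiD2 (i1 : A1 →ₗ[R] B11) (i2 : A1 →ₗ[R] B12)
    (f1 : B11 →ₗ[R] B21) (f2 : B12 →ₗ[R] B22)
    (p1 : B21 →ₗ[R] B3) (p2 : B22 →ₗ[R] B3)
    (hh1 : LinearMap.range f1 = LinearMap.ker p1)
    (hh2 : LinearMap.range f2 = LinearMap.ker p2) :
    Submodule R (rabiH2 p1 p2) :=
  LinearMap.range (LinearMap.codRestrict (rabiH2 p1 p2) ((f1.comp i1).prod (f2.comp i2))
    (fun a => by
      rw [rabiH2, mem_rabiKer]
      simp [apply_eq_zero_of_exact hh1, apply_eq_zero_of_exact hh2]))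

/-- `𝔹₂ = H₂/D₂`. -/
abbrev rabiB2 (i1 : A1 →ₗ[R] B11) (i2 : A1 →ₗ[R] B12)
    (f1 : B11 →ₗ[R] B21) (f2 : B12 →ₗ[R] B22)
    (p1 : B21 →ₗ[R] B3) (p2 : B22 →ₗ[R] B3)
    (hh1 : LinearMap.range f1 = LinearMap.ker p1)
    (hh2 : LinearMap.range f2 = LinearMap.ker p2) :=
  rabiH2 p1 p2 ⧸ rabiD2 i1 i2 f1 f2 p1 p2 hh1 hh2

/-- The map `H₁ → H₂` induced by `(b₁,b₂) ↦ (f₁(b₁), f₂(b₂))`. -/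
def rabiG (pi1 : B11 →ₗ[R] C1) (pi2 : B12 →ₗ[R] C1)
    (f1 : B11 →ₗ[R] B21) (f2 : B12 →ₗ[R] B22)
    (p1 : B21 →ₗ[R] B3) (p2 : B22 →ₗ[R] B3)
    (hh1 : LinearMap.range f1 = LinearMap.ker p1)
    (hh2 : LinearMap.range f2 = LinearMap.ker p2) :
    rabiH1 pi1 pi2 →ₗ[R] rabiH2 p1 p2 :=
  LinearMap.codRestrict (rabiH2 p1 p2) ((f1.prodMap f2).comp (rabiH1 pi1 pi2).subtype)
    (fun x => by
      rw [rabiH2, mem_rabiKer]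
      simp [apply_eq_zero_of_exact hh1, apply_eq_zero_of_exact hh2])

lemma rabiD1_le_comap (i1 : A1 →ₗ[R] B11) (i2 : A1 →ₗ[R] B12)
    (pi1 : B11 →ₗ[R] C1) (pi2 : B12 →ₗ[R] C1)
    (f1 : B11 →ₗ[R] B21) (f2 : B12 →ₗ[R] B22)
    (p1 : B21 →ₗ[R] B3) (p2 : B22 →ₗ[R] B3)
    (hv1 : LinearMap.range i1 = LinearMap.ker pi1)
    (hv2 : LinearMap.range i2 = LinearMap.ker pi2)
    (hh1 : LinearMap.range f1 = LinearMap.ker p1)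
    (hh2 : LinearMap.range f2 = LinearMap.ker p2) :
    rabiD1 i1 i2 pi1 pi2 hv1 hv2 ≤
      (rabiD2 i1 i2 f1 f2 p1 p2 hh1 hh2).comap (rabiG pi1 pi2 f1 f2 p1 p2 hh1 hh2) := by
  rintro x ⟨a, rfl⟩
  refine ⟨a, ?_⟩
  apply Subtype.ext
  simp [rabiG, rabiD1, rabiD2, LinearMap.codRestrict_apply]

/-- The induced map `f : 𝔹₁ → 𝔹₂`. -/
def rabiFbar (i1 : A1 →ₗ[R] B11) (i2 : A1 →ₗ[R] B12)
    (pi1 : B11 →ₗ[R] C1) (pi2 : B12 →ₗ[R] C1)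
    (f1 : B11 →ₗ[R] B21) (f2 : B12 →ₗ[R] B22)
    (p1 : B21 →ₗ[R] B3) (p2 : B22 →ₗ[R] B3)
    (hv1 : LinearMap.range i1 = LinearMap.ker pi1)
    (hv2 : LinearMap.range i2 = LinearMap.ker pi2)
    (hh1 : LinearMap.range f1 = LinearMap.ker p1)
    (hh2 : LinearMap.range f2 = LinearMap.ker p2) :
    rabiB1 i1 i2 pi1 pi2 hv1 hv2 →ₗ[R] rabiB2 i1 i2 f1 f2 p1 p2 hh1 hh2 :=
  Submodule.mapQ _ _ (rabiG pi1 pi2 f1 f2 p1 p2 hh1 hh2)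
    (rabiD1_le_comap i1 i2 pi1 pi2 f1 f2 p1 p2 hv1 hv2 hh1 hh2)

/-- `𝔽 = 𝔹₂ / range(f)`. -/
abbrev rabiF (i1 : A1 →ₗ[R] B11) (i2 : A1 →ₗ[R] B12)
    (pi1 : B11 →ₗ[R] C1) (pi2 : B12 →ₗ[R] C1)
    (f1 : B11 →ₗ[R] B21) (f2 : B12 →ₗ[R] B22)
    (p1 : B21 →ₗ[R] B3) (p2 : B22 →ₗ[R] B3)
    (hv1 : LinearMap.range i1 = LinearMap.ker pi1)
    (hv2 : LinearMap.range i2 = LinearMap.ker pi2)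
    (hh1 : LinearMap.range f1 = LinearMap.ker p1)
    (hh2 : LinearMap.range f2 = LinearMap.ker p2) :=
  rabiB2 i1 i2 f1 f2 p1 p2 hh1 hh2 ⧸
    LinearMap.range (rabiFbar i1 i2 pi1 pi2 f1 f2 p1 p2 hv1 hv2 hh1 hh2)

/-- The horizontal exact sequence in Rabi's lemma: the map `f : 𝔹₁ → 𝔹₂` induced by
`(b₁,b₂) ↦ (f₁(b₁), f₂(b₂))` is well defined and injective, and
`0 → 𝔹₁ → 𝔹₂ → 𝔽 → 0` is a short exact sequence, where `η` is the quotient map. -/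
theorem rabi_horizontal_short_exact
    (i1 : A1 →ₗ[R] B11) (i2 : A1 →ₗ[R] B12)
    (pi1 : B11 →ₗ[R] C1) (pi2 : B12 →ₗ[R] C1)
    (f1 : B11 →ₗ[R] B21) (f2 : B12 →ₗ[R] B22)
    (p1 : B21 →ₗ[R] B3) (p2 : B22 →ₗ[R] B3)
    (hi1 : Function.Injective i1) (hpi1 : Function.Surjective pi1)
    (hv1 : LinearMap.range i1 = LinearMap.ker pi1)
    (hi2 : Function.Injective i2) (hpi2 : Function.Surjective pi2)
    (hv2 : LinearMap.range i2 = LinearMap.ker pi2)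
    (hf1 : Function.Injective f1) (hp1 : Function.Surjective p1)
    (hh1 : LinearMap.range f1 = LinearMap.ker p1)
    (hf2 : Function.Injective f2) (hp2 : Function.Surjective p2)
    (hh2 : LinearMap.range f2 = LinearMap.ker p2) :
    (∀ x : rabiH1 pi1 pi2,
      rabiFbar i1 i2 pi1 pi2 f1 f2 p1 p2 hv1 hv2 hh1 hh2
          ((rabiD1 i1 i2 pi1 pi2 hv1 hv2).mkQ x) =
        (rabiD2 i1 i2 f1 f2 p1 p2 hh1 hh2).mkQ
          (rabiG pi1 pi2 f1 f2 p1 p2 hh1 hh2 x)) ∧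
    Function.Injective (rabiFbar i1 i2 pi1 pi2 f1 f2 p1 p2 hv1 hv2 hh1 hh2) ∧
    Function.Surjective
      (LinearMap.range (rabiFbar i1 i2 pi1 pi2 f1 f2 p1 p2 hv1 hv2 hh1 hh2)).mkQ ∧
    LinearMap.range (rabiFbar i1 i2 pi1 pi2 f1 f2 p1 p2 hv1 hv2 hh1 hh2) =
      LinearMap.ker
        (LinearMap.range (rabiFbar i1 i2 pi1 pi2 f1 f2 p1 p2 hv1 hv2 hh1 hh2)).mkQ := by
  refine ⟨fun _ => rfl, ?_, Submodule.mkQ_surjective _, (Submodule.ker_mkQ _).symm⟩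
  rw [injective_iff_map_eq_zero]
  intro y
  obtain ⟨x, rfl⟩ := Submodule.mkQ_surjective _ y
  intro hx
  obtain ⟨a, ha⟩ := (Submodule.Quotient.mk_eq_zero _).mp hx
  refine (Submodule.Quotient.mk_eq_zero _).mpr ⟨a, Subtype.ext (Prod.ext ?_ ?_)⟩
  · exact hf1 (congrArg (fun z => z.1.1) ha)
  · exact hf2 (congrArg (fun z => z.1.2) ha)
end

section
/- With the above data, there exists a unique R-linear map φ : C₁ → 𝔽 such that for every b ∈ B₁¹, φ(π₁(b)) equals the class in 𝔽 of (f₁(b), 0) ∈ H₂. (In particular, the class of (f₁(b), 0) in 𝔽 depends only on π₁(b): if π₁(b) = π₁(b'), then (f₁(b), 0) − (f₁(b'), 0) lies in D₂ + (f₁ × f₂)(H₁). This is the well-definedness of the map φ in Rabi's lemma, Lemma 3.4 of the paper.) -/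
variable {R : Type*} [Ring R]
variable {A1 B11 B12 B21 B22 B3 C1 : Type*}
variable [AddCommGroup A1] [Module R A1]
variable [AddCommGroup B11] [Module R B11] [AddCommGroup B12] [Module R B12]
variable [AddCommGroup B21] [Module R B21] [AddCommGroup B22] [Module R B22]
variable [AddCommGroup B3] [Module R B3] [AddCommGroup C1] [Module R C1]

lemma left_mem_rabiH2 {f1 : B11 →ₗ[R] B21} {p1 : B21 →ₗ[R] B3} (p2 : B22 →ₗ[R] B3)
    (hh1 : LinearMap.range f1 = LinearMap.ker p1) (b : B11) :
    ((f1 b, 0) : B21 × B22) ∈ rabiH2 p1 p2 := by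
  rw [rabiH2, mem_rabiKer]
  simp [apply_eq_zero_of_exact hh1]

/-- A linear map that vanishes on the kernel of a surjective linear map factors uniquely
through it. -/
lemma existsUnique_comp_eq_of_surjective {M N P : Type*} [AddCommGroup M] [Module R M]
    [AddCommGroup N] [Module R N] [AddCommGroup P] [Module R P] {p : M →ₗ[R] N}
    (hp : Function.Surjective p) (g : M →ₗ[R] P)
    (h : LinearMap.ker p ≤ LinearMap.ker g) :
    ∃! φ : N →ₗ[R] P, ∀ x, φ (p x) = g x := by
  refine ⟨(LinearMap.ker p).liftQ g h ∘ₗ (p.quotKerEquivOfSurjective hp).symm, fun x => ?_,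
    fun φ hφ => ?_⟩
  · have hx : (p.quotKerEquivOfSurjective hp).symm (p x) = Submodule.Quotient.mk x :=
      (LinearEquiv.symm_apply_eq _).mpr rfl
    simp [hx]
  · ext y
    obtain ⟨x, rfl⟩ := hp y
    have hx : (p.quotKerEquivOfSurjective hp).symm (p x) = Submodule.Quotient.mk x :=
      (LinearEquiv.symm_apply_eq _).mpr rfl
    simp [hx, hφ x]

/-- Well-definedness of the map `φ` in Rabi's lemma: there is a unique linear map
`φ : C₁ → 𝔽` such that for every `b ∈ B₁¹`, `φ(π₁(b))` is the class in `𝔽` of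
`(f₁(b), 0) ∈ H₂`. -/
theorem rabi_phi_well_defined
    (i1 : A1 →ₗ[R] B11) (i2 : A1 →ₗ[R] B12)
    (pi1 : B11 →ₗ[R] C1) (pi2 : B12 →ₗ[R] C1)
    (f1 : B11 →ₗ[R] B21) (f2 : B12 →ₗ[R] B22)
    (p1 : B21 →ₗ[R] B3) (p2 : B22 →ₗ[R] B3)
    (hi1 : Function.Injective i1) (hpi1 : Function.Surjective pi1)
    (hv1 : LinearMap.range i1 = LinearMap.ker pi1)
    (hi2 : Function.Injective i2) (hpi2 : Function.Surjective pi2)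
    (hv2 : LinearMap.range i2 = LinearMap.ker pi2)
    (hf1 : Function.Injective f1) (hp1 : Function.Surjective p1)
    (hh1 : LinearMap.range f1 = LinearMap.ker p1)
    (hf2 : Function.Injective f2) (hp2 : Function.Surjective p2)
    (hh2 : LinearMap.range f2 = LinearMap.ker p2) :
    ∃! φ : C1 →ₗ[R] rabiF i1 i2 pi1 pi2 f1 f2 p1 p2 hv1 hv2 hh1 hh2,
      ∀ b : B11,
        φ (pi1 b) =
          (LinearMap.range (rabiFbar i1 i2 pi1 pi2 f1 f2 p1 p2 hv1 hv2 hh1 hh2)).mkQ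
            ((rabiD2 i1 i2 f1 f2 p1 p2 hh1 hh2).mkQ
              ⟨(f1 b, 0), left_mem_rabiH2 p2 hh1 b⟩) := by
  let ψ : B11 →ₗ[R] rabiF i1 i2 pi1 pi2 f1 f2 p1 p2 hv1 hv2 hh1 hh2 :=
    (LinearMap.range (rabiFbar i1 i2 pi1 pi2 f1 f2 p1 p2 hv1 hv2 hh1 hh2)).mkQ ∘ₗ
      (rabiD2 i1 i2 f1 f2 p1 p2 hh1 hh2).mkQ ∘ₗ
        LinearMap.codRestrict (rabiH2 p1 p2) (f1.prod 0) (left_mem_rabiH2 p2 hh1)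
  refine existsUnique_comp_eq_of_surjective hpi1 ψ fun b hb => ?_
  have hmem : ((b, 0) : B11 × B12) ∈ rabiH1 pi1 pi2 := by
    rw [rabiH1, mem_rabiKer]
    simpa using hb
  refine LinearMap.mem_ker.mpr ((Submodule.Quotient.mk_eq_zero _).mpr ?_)
  refine ⟨Submodule.Quotient.mk ⟨(b, 0), hmem⟩, ?_⟩
  exact congrArg (rabiD2 i1 i2 f1 f2 p1 p2 hh1 hh2).mkQ
    (Subtype.ext (Prod.ext rfl (map_zero f2)))
end

section
/- With the above data, there exists a unique R-linear map p̄ : 𝔽 → B₃ such that for every (x, y) ∈ H₂, p̄ applied to the class of (x, y) in 𝔽 equals p₁(x); moreover p̄ is surjective, and for every (x, y) ∈ H₂ one also has p̄(class of (x,y)) = p₂(y). (This is the well-definedness and surjectivity of the map p̄ in Rabi's lemma, Lemma 3.4 of the paper.) -/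
variable {R : Type*} [Ring R]
variable {A1 B11 B12 B21 B22 B3 C1 : Type*}
variable [AddCommGroup A1] [Module R A1]
variable [AddCommGroup B11] [Module R B11] [AddCommGroup B12] [Module R B12]
variable [AddCommGroup B21] [Module R B21] [AddCommGroup B22] [Module R B22]
variable [AddCommGroup B3] [Module R B3] [AddCommGroup C1] [Module R C1]

/-- Well-definedness and surjectivity of `p̄` in Rabi's lemma: there is a unique linear
map `p̄ : 𝔽 → B₃` with `p̄([(x,y)]) = p₁(x)` for all `(x,y) ∈ H₂`; moreover `p̄` is
surjective and also satisfies `p̄([(x,y)]) = p₂(y)`. -/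
theorem rabi_pbar_well_defined
    (i1 : A1 →ₗ[R] B11) (i2 : A1 →ₗ[R] B12)
    (pi1 : B11 →ₗ[R] C1) (pi2 : B12 →ₗ[R] C1)
    (f1 : B11 →ₗ[R] B21) (f2 : B12 →ₗ[R] B22)
    (p1 : B21 →ₗ[R] B3) (p2 : B22 →ₗ[R] B3)
    (hi1 : Function.Injective i1) (hpi1 : Function.Surjective pi1)
    (hv1 : LinearMap.range i1 = LinearMap.ker pi1)
    (hi2 : Function.Injective i2) (hpi2 : Function.Surjective pi2)
    (hv2 : LinearMap.range i2 = LinearMap.ker pi2)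
    (hf1 : Function.Injective f1) (hp1 : Function.Surjective p1)
    (hh1 : LinearMap.range f1 = LinearMap.ker p1)
    (hf2 : Function.Injective f2) (hp2 : Function.Surjective p2)
    (hh2 : LinearMap.range f2 = LinearMap.ker p2) :
    ∃ pbar : rabiF i1 i2 pi1 pi2 f1 f2 p1 p2 hv1 hv2 hh1 hh2 →ₗ[R] B3,
      (∀ x : rabiH2 p1 p2,
        pbar ((LinearMap.range (rabiFbar i1 i2 pi1 pi2 f1 f2 p1 p2 hv1 hv2 hh1 hh2)).mkQ
            ((rabiD2 i1 i2 f1 f2 p1 p2 hh1 hh2).mkQ x)) = p1 x.1.1) ∧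
      (∀ q : rabiF i1 i2 pi1 pi2 f1 f2 p1 p2 hv1 hv2 hh1 hh2 →ₗ[R] B3,
        (∀ x : rabiH2 p1 p2,
          q ((LinearMap.range (rabiFbar i1 i2 pi1 pi2 f1 f2 p1 p2 hv1 hv2 hh1 hh2)).mkQ
              ((rabiD2 i1 i2 f1 f2 p1 p2 hh1 hh2).mkQ x)) = p1 x.1.1) → q = pbar) ∧
      Function.Surjective pbar ∧
      (∀ x : rabiH2 p1 p2,
        pbar ((LinearMap.range (rabiFbar i1 i2 pi1 pi2 f1 f2 p1 p2 hv1 hv2 hh1 hh2)).mkQ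
            ((rabiD2 i1 i2 f1 f2 p1 p2 hh1 hh2).mkQ x)) = p2 x.1.2) := by
  let p : rabiH2 p1 p2 →ₗ[R] B3 :=
    (p1.comp (LinearMap.fst R B21 B22)).comp (rabiH2 p1 p2).subtype
  have hD : rabiD2 i1 i2 f1 f2 p1 p2 hh1 hh2 ≤ LinearMap.ker p := by
    rintro _ ⟨a, rfl⟩
    exact apply_eq_zero_of_exact hh1 (i1 a)
  have hF : LinearMap.range (rabiFbar i1 i2 pi1 pi2 f1 f2 p1 p2 hv1 hv2 hh1 hh2) ≤
      LinearMap.ker ((rabiD2 i1 i2 f1 f2 p1 p2 hh1 hh2).liftQ p hD) := by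
    rintro _ ⟨b, rfl⟩
    obtain ⟨x, rfl⟩ := Submodule.mkQ_surjective _ b
    exact apply_eq_zero_of_exact hh1 x.1.1
  refine ⟨Submodule.liftQ _ _ hF, fun x => rfl, fun q hq => ?_, fun b => ?_,
    fun x => mem_rabiKer.mp x.2⟩
  · ext x
    exact hq x
  · obtain ⟨x, rfl⟩ := hp1 b
    obtain ⟨y, hy⟩ := hp2 (p1 x)
    exact ⟨Submodule.mkQ _ (Submodule.mkQ _ ⟨(x, y), mem_rabiKer.mpr hy.symm⟩), rfl⟩
end

section
/- With the above data, let φ : C₁ → 𝔽 be the unique R-linear map with φ(π₁(b)) = class of (f₁(b), 0) for all b ∈ B₁¹, and let p̄ : 𝔽 → B₃ be the unique R-linear map with p̄(class of (x,y)) = p₁(x) for all (x,y) ∈ H₂. Then φ is injective, p̄ is surjective, and range(φ) = ker(p̄); that is, 0 → C₁ →^{φ} 𝔽 →^{p̄} B₃ → 0 is a short exact sequence of R-modules. (This is the vertical exact sequence in Rabi's lemma, Lemma 3.4 of the paper.) -/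
variable {R : Type*} [Ring R]
variable {A1 B11 B12 B21 B22 B3 C1 : Type*}
variable [AddCommGroup A1] [Module R A1]
variable [AddCommGroup B11] [Module R B11] [AddCommGroup B12] [Module R B12]
variable [AddCommGroup B21] [Module R B21] [AddCommGroup B22] [Module R B22]
variable [AddCommGroup B3] [Module R B3] [AddCommGroup C1] [Module R C1]

/-- The class in `𝔽` of an element of `H₂` vanishes exactly when it lies in the image of `H₁`. -/
lemma rabiF_mk_eq_zero_iff (i1 : A1 →ₗ[R] B11) (i2 : A1 →ₗ[R] B12)
    (pi1 : B11 →ₗ[R] C1) (pi2 : B12 →ₗ[R] C1)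
    (f1 : B11 →ₗ[R] B21) (f2 : B12 →ₗ[R] B22)
    (p1 : B21 →ₗ[R] B3) (p2 : B22 →ₗ[R] B3)
    (hv1 : LinearMap.range i1 = LinearMap.ker pi1)
    (hv2 : LinearMap.range i2 = LinearMap.ker pi2)
    (hh1 : LinearMap.range f1 = LinearMap.ker p1)
    (hh2 : LinearMap.range f2 = LinearMap.ker p2) (x : rabiH2 p1 p2) :
    (LinearMap.range (rabiFbar i1 i2 pi1 pi2 f1 f2 p1 p2 hv1 hv2 hh1 hh2)).mkQ
        ((rabiD2 i1 i2 f1 f2 p1 p2 hh1 hh2).mkQ x) = 0 ↔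
      ∃ b c, pi1 b = pi2 c ∧ f1 b = x.1.1 ∧ f2 c = x.1.2 := by
  rw [Submodule.mkQ_apply, Submodule.Quotient.mk_eq_zero]
  constructor
  · rintro ⟨y, hy⟩
    obtain ⟨y, rfl⟩ := Submodule.mkQ_surjective _ y
    obtain ⟨a, ha⟩ := (Submodule.Quotient.eq _).mp hy
    have h1 : f1 (i1 a) = f1 y.1.1 - x.1.1 := congrArg (fun z => z.1.1) ha
    have h2 : f2 (i2 a) = f2 y.1.2 - x.1.2 := congrArg (fun z => z.1.2) ha
    have hy' : pi1 y.1.1 = pi2 y.1.2 := mem_rabiKer.mp y.2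
    refine ⟨y.1.1 - i1 a, y.1.2 - i2 a, ?_, ?_, ?_⟩
    · simp [apply_eq_zero_of_exact hv1, apply_eq_zero_of_exact hv2, hy']
    · simp [h1]
    · simp [h2]
  · rintro ⟨b, c, hbc, hb, hc⟩
    refine ⟨(rabiD1 i1 i2 pi1 pi2 hv1 hv2).mkQ ⟨(b, c), mem_rabiKer.mpr hbc⟩, ?_⟩
    have hx : rabiG pi1 pi2 f1 f2 p1 p2 hh1 hh2 ⟨(b, c), mem_rabiKer.mpr hbc⟩ = x :=
      Subtype.ext (Prod.ext hb hc)
    exact congrArg (rabiD2 i1 i2 f1 f2 p1 p2 hh1 hh2).mkQ hx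

/-- The vertical exact sequence in Rabi's lemma: if `φ : C₁ → 𝔽` is the (unique) linear
map with `φ(π₁(b)) = [(f₁(b),0)]` for all `b ∈ B₁¹`, and `p̄ : 𝔽 → B₃` is the (unique)
linear map with `p̄([(x,y)]) = p₁(x)` for all `(x,y) ∈ H₂`, then `φ` is injective, `p̄`
is surjective, and `range(φ) = ker(p̄)`; that is, `0 → C₁ → 𝔽 → B₃ → 0` is a short
exact sequence. -/
theorem rabi_vertical_short_exact
    (i1 : A1 →ₗ[R] B11) (i2 : A1 →ₗ[R] B12)
    (pi1 : B11 →ₗ[R] C1) (pi2 : B12 →ₗ[R] C1)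
    (f1 : B11 →ₗ[R] B21) (f2 : B12 →ₗ[R] B22)
    (p1 : B21 →ₗ[R] B3) (p2 : B22 →ₗ[R] B3)
    (hi1 : Function.Injective i1) (hpi1 : Function.Surjective pi1)
    (hv1 : LinearMap.range i1 = LinearMap.ker pi1)
    (hi2 : Function.Injective i2) (hpi2 : Function.Surjective pi2)
    (hv2 : LinearMap.range i2 = LinearMap.ker pi2)
    (hf1 : Function.Injective f1) (hp1 : Function.Surjective p1)
    (hh1 : LinearMap.range f1 = LinearMap.ker p1)
    (hf2 : Function.Injective f2) (hp2 : Function.Surjective p2)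
    (hh2 : LinearMap.range f2 = LinearMap.ker p2)
    (φ : C1 →ₗ[R] rabiF i1 i2 pi1 pi2 f1 f2 p1 p2 hv1 hv2 hh1 hh2)
    (pbar : rabiF i1 i2 pi1 pi2 f1 f2 p1 p2 hv1 hv2 hh1 hh2 →ₗ[R] B3)
    (hφ : ∀ b : B11,
      φ (pi1 b) =
        (LinearMap.range (rabiFbar i1 i2 pi1 pi2 f1 f2 p1 p2 hv1 hv2 hh1 hh2)).mkQ
          ((rabiD2 i1 i2 f1 f2 p1 p2 hh1 hh2).mkQ ⟨(f1 b, 0), left_mem_rabiH2 p2 hh1 b⟩))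
    (hpbar : ∀ x : rabiH2 p1 p2,
      pbar ((LinearMap.range (rabiFbar i1 i2 pi1 pi2 f1 f2 p1 p2 hv1 hv2 hh1 hh2)).mkQ
          ((rabiD2 i1 i2 f1 f2 p1 p2 hh1 hh2).mkQ x)) = p1 x.1.1) :
    Function.Injective φ ∧ Function.Surjective pbar ∧
      LinearMap.range φ = LinearMap.ker pbar := by
  have hzero := rabiF_mk_eq_zero_iff i1 i2 pi1 pi2 f1 f2 p1 p2 hv1 hv2 hh1 hh2
  refine ⟨?_, ?_, le_antisymm ?_ ?_⟩
  · rw [injective_iff_map_eq_zero]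
    intro c hc
    obtain ⟨b, rfl⟩ := hpi1 c
    rw [hφ, hzero] at hc
    obtain ⟨b', c', h, hb, hc'⟩ := hc
    rw [← hf1 hb, h, hf2 (hc'.trans (map_zero f2).symm), map_zero]
  · intro z
    obtain ⟨x, hx⟩ := hp1 z
    obtain ⟨y, hy⟩ := hp2 z
    exact ⟨_, (hpbar ⟨(x, y), mem_rabiKer.mpr (hx.trans hy.symm)⟩).trans hx⟩
  · rintro _ ⟨c, rfl⟩
    obtain ⟨b, rfl⟩ := hpi1 c
    rw [LinearMap.mem_ker, hφ, hpbar]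
    exact apply_eq_zero_of_exact hh1 b
  · intro z hz
    obtain ⟨z, rfl⟩ := Submodule.mkQ_surjective _ z
    obtain ⟨x, rfl⟩ := Submodule.mkQ_surjective _ z
    rw [LinearMap.mem_ker, hpbar] at hz
    have hz2 : p2 x.1.2 = 0 := (mem_rabiKer.mp x.2).symm.trans hz
    obtain ⟨b, hb⟩ : x.1.1 ∈ LinearMap.range f1 := hh1 ▸ hz
    obtain ⟨c, hc⟩ : x.1.2 ∈ LinearMap.range f2 := hh2 ▸ hz2
    obtain ⟨b', hb'⟩ := hpi1 (pi2 c)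
    refine ⟨pi1 (b - b'), ?_⟩
    rw [hφ, ← sub_eq_zero, ← map_sub, ← map_sub, hzero]
    refine ⟨-b', -c, by simp [hb'], ?_, ?_⟩
    · simp [hb]
    · simp [hc]
end

section
/- With the above data, let p̄₂ : 𝔹₂ → B₃ be the R-linear map induced by (x, y) ↦ p₁(x) (well defined since p₁ vanishes on the first coordinates of elements of D₂). Then the composite p̄₂ ∘ f : 𝔹₁ → B₃ is zero, so 0 → 𝔹₁ → 𝔹₂ → B₃ → 0 is a complex; it is not in general exact, and its homology at 𝔹₂ is C₁: there is an R-module isomorphism ker(p̄₂) / range(f) ≅ C₁. (This is the measure of inexactness of the generalised Baer difference, from Lemma 3.4 of the paper.) -/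
variable {R : Type*} [Ring R]
variable {A1 B11 B12 B21 B22 B3 C1 : Type*}
variable [AddCommGroup A1] [Module R A1]
variable [AddCommGroup B11] [Module R B11] [AddCommGroup B12] [Module R B12]
variable [AddCommGroup B21] [Module R B21] [AddCommGroup B22] [Module R B22]
variable [AddCommGroup B3] [Module R B3] [AddCommGroup C1] [Module R C1]

/-- The map `p̄₂ : 𝔹₂ → B₃` induced by `(x,y) ↦ p₁(x)`; it is well defined since `p₁`
vanishes on the first coordinates of elements of `D₂`. -/
def rabiPbar2 (i1 : A1 →ₗ[R] B11) (i2 : A1 →ₗ[R] B12)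
    (f1 : B11 →ₗ[R] B21) (f2 : B12 →ₗ[R] B22)
    (p1 : B21 →ₗ[R] B3) (p2 : B22 →ₗ[R] B3)
    (hh1 : LinearMap.range f1 = LinearMap.ker p1)
    (hh2 : LinearMap.range f2 = LinearMap.ker p2) :
    rabiB2 i1 i2 f1 f2 p1 p2 hh1 hh2 →ₗ[R] B3 :=
  Submodule.liftQ (rabiD2 i1 i2 f1 f2 p1 p2 hh1 hh2)
    (p1.comp ((LinearMap.fst R B21 B22).comp (rabiH2 p1 p2).subtype))
    (by
      rintro x ⟨a, rfl⟩
      rw [LinearMap.mem_ker]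
      simp [rabiD2, LinearMap.codRestrict_apply, apply_eq_zero_of_exact hh1])

/-- The map `B₁¹ × B₁² → ker(p̄₂)` given by `(b₁,b₂) ↦ [(f₁(b₁), f₂(b₂))]`. -/
def rabiProdToKer (i1 : A1 →ₗ[R] B11) (i2 : A1 →ₗ[R] B12)
    (f1 : B11 →ₗ[R] B21) (f2 : B12 →ₗ[R] B22)
    (p1 : B21 →ₗ[R] B3) (p2 : B22 →ₗ[R] B3)
    (hh1 : LinearMap.range f1 = LinearMap.ker p1)
    (hh2 : LinearMap.range f2 = LinearMap.ker p2) :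
    B11 × B12 →ₗ[R] LinearMap.ker (rabiPbar2 i1 i2 f1 f2 p1 p2 hh1 hh2) :=
  LinearMap.codRestrict _
    ((rabiD2 i1 i2 f1 f2 p1 p2 hh1 hh2).mkQ.comp
      (LinearMap.codRestrict (rabiH2 p1 p2) (f1.prodMap f2) (fun x => by
        rw [rabiH2, mem_rabiKer]
        simp [apply_eq_zero_of_exact hh1, apply_eq_zero_of_exact hh2])))
    (fun x => apply_eq_zero_of_exact hh1 x.1)

lemma rabiProdToKer_surjective (i1 : A1 →ₗ[R] B11) (i2 : A1 →ₗ[R] B12)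
    (f1 : B11 →ₗ[R] B21) (f2 : B12 →ₗ[R] B22)
    (p1 : B21 →ₗ[R] B3) (p2 : B22 →ₗ[R] B3)
    (hh1 : LinearMap.range f1 = LinearMap.ker p1)
    (hh2 : LinearMap.range f2 = LinearMap.ker p2) :
    Function.Surjective (rabiProdToKer i1 i2 f1 f2 p1 p2 hh1 hh2) := by
  rintro ⟨y, hy⟩
  obtain ⟨⟨⟨x1, x2⟩, hx⟩, rfl⟩ := Submodule.mkQ_surjective _ y
  have h1 : p1 x1 = 0 := hy
  have h2 : p2 x2 = 0 := (mem_rabiKer.mp hx).symm.trans h1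
  obtain ⟨b1, rfl⟩ : x1 ∈ LinearMap.range f1 := hh1 ▸ LinearMap.mem_ker.mpr h1
  obtain ⟨b2, rfl⟩ : x2 ∈ LinearMap.range f2 := hh2 ▸ LinearMap.mem_ker.mpr h2
  exact ⟨(b1, b2), rfl⟩

/-- The class of `(f₁(b₁), f₂(b₂))` comes from `𝔹₁` exactly when `(b₁,b₂) ∈ H₁`. -/
lemma rabiProdToKer_mem_range_rabiFbar_iff (i1 : A1 →ₗ[R] B11) (i2 : A1 →ₗ[R] B12)
    (pi1 : B11 →ₗ[R] C1) (pi2 : B12 →ₗ[R] C1)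
    (f1 : B11 →ₗ[R] B21) (f2 : B12 →ₗ[R] B22)
    (p1 : B21 →ₗ[R] B3) (p2 : B22 →ₗ[R] B3)
    (hv1 : LinearMap.range i1 = LinearMap.ker pi1)
    (hv2 : LinearMap.range i2 = LinearMap.ker pi2)
    (hf1 : Function.Injective f1) (hh1 : LinearMap.range f1 = LinearMap.ker p1)
    (hf2 : Function.Injective f2) (hh2 : LinearMap.range f2 = LinearMap.ker p2)
    (b : B11 × B12) :
    (rabiProdToKer i1 i2 f1 f2 p1 p2 hh1 hh2 b : rabiB2 i1 i2 f1 f2 p1 p2 hh1 hh2) ∈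
        LinearMap.range (rabiFbar i1 i2 pi1 pi2 f1 f2 p1 p2 hv1 hv2 hh1 hh2) ↔
      b ∈ rabiH1 pi1 pi2 := by
  constructor
  · rintro ⟨y, hy⟩
    obtain ⟨⟨h, hh⟩, rfl⟩ := Submodule.mkQ_surjective _ y
    obtain ⟨a, ha⟩ := (Submodule.Quotient.eq _).mp hy
    have ha := congrArg Subtype.val ha
    have e1 : f1 (i1 a) = f1 h.1 - f1 b.1 := congrArg Prod.fst ha
    have e2 : f2 (i2 a) = f2 h.2 - f2 b.2 := congrArg Prod.snd ha
    rw [← map_sub] at e1 e2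
    have k1 := congrArg pi1 (hf1 e1)
    have k2 := congrArg pi2 (hf2 e2)
    rw [apply_eq_zero_of_exact hv1, map_sub, eq_comm, sub_eq_zero] at k1
    rw [apply_eq_zero_of_exact hv2, map_sub, eq_comm, sub_eq_zero] at k2
    exact mem_rabiKer.mpr (k1.symm.trans ((mem_rabiKer.mp hh).trans k2))
  · intro hb
    exact ⟨Submodule.Quotient.mk ⟨b, hb⟩, rfl⟩

/-- The generalised Baer difference `0 → 𝔹₁ → 𝔹₂ → B₃ → 0` is a complex
(`p̄₂ ∘ f = 0`) whose homology at `𝔹₂` is `C₁`: there is an isomorphism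
`ker(p̄₂)/range(f) ≅ C₁`. Here `p̄₂` is characterised by `p̄₂([(x,y)]) = p₁(x)`. -/
theorem rabi_homology_at_B2
    (i1 : A1 →ₗ[R] B11) (i2 : A1 →ₗ[R] B12)
    (pi1 : B11 →ₗ[R] C1) (pi2 : B12 →ₗ[R] C1)
    (f1 : B11 →ₗ[R] B21) (f2 : B12 →ₗ[R] B22)
    (p1 : B21 →ₗ[R] B3) (p2 : B22 →ₗ[R] B3)
    (hi1 : Function.Injective i1) (hpi1 : Function.Surjective pi1)
    (hv1 : LinearMap.range i1 = LinearMap.ker pi1)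
    (hi2 : Function.Injective i2) (hpi2 : Function.Surjective pi2)
    (hv2 : LinearMap.range i2 = LinearMap.ker pi2)
    (hf1 : Function.Injective f1) (hp1 : Function.Surjective p1)
    (hh1 : LinearMap.range f1 = LinearMap.ker p1)
    (hf2 : Function.Injective f2) (hp2 : Function.Surjective p2)
    (hh2 : LinearMap.range f2 = LinearMap.ker p2) :
    (∀ x : rabiH2 p1 p2,
      rabiPbar2 i1 i2 f1 f2 p1 p2 hh1 hh2
          ((rabiD2 i1 i2 f1 f2 p1 p2 hh1 hh2).mkQ x) = p1 x.1.1) ∧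
    (rabiPbar2 i1 i2 f1 f2 p1 p2 hh1 hh2).comp
        (rabiFbar i1 i2 pi1 pi2 f1 f2 p1 p2 hv1 hv2 hh1 hh2) = 0 ∧
    Nonempty
      ((↥(LinearMap.ker (rabiPbar2 i1 i2 f1 f2 p1 p2 hh1 hh2)) ⧸
          Submodule.comap (LinearMap.ker (rabiPbar2 i1 i2 f1 f2 p1 p2 hh1 hh2)).subtype
            (LinearMap.range (rabiFbar i1 i2 pi1 pi2 f1 f2 p1 p2 hv1 hv2 hh1 hh2)))
        ≃ₗ[R] C1) := by
  refine ⟨fun x => rfl, ?_, ?_⟩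
  · ext x
    exact apply_eq_zero_of_exact hh1 x.1.1
  · let δ : B11 × B12 →ₗ[R] C1 :=
      pi1.comp (LinearMap.fst R B11 B12) - pi2.comp (LinearMap.snd R B11 B12)
    have hδ : Function.Surjective δ := fun c => by
      obtain ⟨b, rfl⟩ := hpi1 c
      exact ⟨(b, 0), by simp [δ]⟩
    let q := (Submodule.comap (LinearMap.ker (rabiPbar2 i1 i2 f1 f2 p1 p2 hh1 hh2)).subtype
      (LinearMap.range (rabiFbar i1 i2 pi1 pi2 f1 f2 p1 p2 hv1 hv2 hh1 hh2))).mkQ.comp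
        (rabiProdToKer i1 i2 f1 f2 p1 p2 hh1 hh2)
    have hq : Function.Surjective q :=
      (Submodule.mkQ_surjective _).comp (rabiProdToKer_surjective i1 i2 f1 f2 p1 p2 hh1 hh2)
    have hker : LinearMap.ker q = LinearMap.ker δ := by
      ext b
      exact (Submodule.Quotient.mk_eq_zero _).trans
        (rabiProdToKer_mem_range_rabiFbar_iff i1 i2 pi1 pi2 f1 f2 p1 p2 hv1 hv2
          hf1 hh1 hf2 hh2 b)
    exact ⟨(q.quotKerEquivOfSurjective hq).symm ≪≫ₗ Submodule.quotEquivOfEq _ _ hker ≪≫ₗ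
      δ.quotKerEquivOfSurjective hδ⟩
end
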